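/- For every M₀ > 0 there exists a constant C > 0 such that for all h ∈ (0,1], all integers N ≥ 1 with Nh ≤ M₀, and every entire function u on ℂⁿ with ‖u‖_{H_{Φ₁}} < ∞, one has ‖τ_N u‖_{H_{Φ₁}} ≤ C e^{C/h} ‖u‖_{H_{Φ₁}}. -/

import Mathlib

open MeasureTheory

/-- The squared Euclidean norm `|x|² = Σ |x_j|²` on ℂⁿ. -/
noncomputable def eNormSq {n : ℕ} (x : Fin n → ℂ) : ℝ := ∑ j, Complex.normSq (x j)

/-- The complex partial derivative `∂u/∂x_j` of a function on ℂⁿ. -/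
noncomputable def pDeriv {n : ℕ} (j : Fin n)
    (u : (Fin n → ℂ) → ℂ) : (Fin n → ℂ) → ℂ :=
  fun x => fderiv ℂ u x (Pi.single j 1)

/-- The iterated complex partial derivative `∂^α u` for a multi-index `α ∈ ℕⁿ`. -/
noncomputable def mDeriv {n : ℕ} (α : Fin n → ℕ)
    (u : (Fin n → ℂ) → ℂ) : (Fin n → ℂ) → ℂ :=
  ((List.finRange n).foldr (fun j f => (pDeriv j)^[α j] ∘ f) id) u

/-- The weighted norm `‖u‖_{H_Φ}`, with `‖u‖²_{H_Φ} = ∫_{ℂⁿ} |u|² e^{−2Φ/h} L(dx)`. -/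
noncomputable def hNorm {n : ℕ} (Φ : (Fin n → ℂ) → ℝ) (h : ℝ)
    (u : (Fin n → ℂ) → ℂ) : ℝ :=
  Real.sqrt (∫ x : Fin n → ℂ, ‖u x‖ ^ 2 * Real.exp (-2 * Φ x / h))

/-- The finite set of multi-indices `α ∈ ℕⁿ` with `|α| < N`. -/
noncomputable def multiIdx (n N : ℕ) : Finset (Fin n → ℕ) :=
  (Fintype.piFinset fun _ : Fin n => Finset.range N).filter fun α => (∑ j, α j) < N

/-- The Taylor truncation `τ_N u(x) = Σ_{|α|<N} (α!)⁻¹ (∂^α u(0)) x^α`. -/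
noncomputable def taylorTrunc {n : ℕ} (N : ℕ) (u : (Fin n → ℂ) → ℂ)
    (x : Fin n → ℂ) : ℂ :=
  ∑ α ∈ multiIdx n N,
    ((∏ j, ((α j).factorial : ℂ)))⁻¹ * mDeriv α u 0 * ∏ j, (x j) ^ α j

lemma fderiv_bound_aux {n : ℕ} {u : (Fin n → ℂ) → ℂ} (hu : Differentiable ℂ u) (r : ℝ) :
    ∃ M : ℝ, ∀ y, ‖y‖ ≤ r → ‖fderiv ℂ u y‖ ≤ M := by
  obtain ⟨B, hB⟩ := (isCompact_closedBall (0 : Fin n → ℂ) (r+1)).exists_bound_of_continuousOn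
    hu.continuous.continuousOn
  refine ⟨(2 * B + 1) / 1, fun y hy => ?_⟩
  apply Complex.norm_fderiv_le_div_of_mapsTo_ball (R₁ := 1) hu.differentiableOn _ one_pos
  intro z hz
  have h1 : ‖z‖ ≤ r + 1 := by
    have : ‖z - y‖ < 1 := by simpa [dist_eq_norm] using hz
    calc ‖z‖ = ‖y + (z - y)‖ := by simp
      _ ≤ ‖y‖ + ‖z - y‖ := norm_add_le _ _
      _ ≤ _ := by linarith
  have hz' := hB z (by simpa using h1)
  have hy' := hB y (by simp; linarith)
  have h3 := norm_sub_le (u z) (u y)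
  simp only [Metric.mem_closedBall, dist_eq_norm]
  linarith

lemma diff_integral_aux {n : ℕ} {u : (Fin n → ℂ) → ℂ} (hu : Differentiable ℂ u)
    {c : ℝ → ℂ} (hc : Continuous c) {γ : ℝ → (Fin n → ℂ)} (hγ : Continuous γ)
    {K : ℝ} (hγK : ∀ θ, ‖γ θ‖ ≤ K) (a b : ℝ) :
    Differentiable ℂ (fun x => ∫ θ in a..b, c θ * u (x + γ θ)) := by
  intro x₀
  obtain ⟨M, hM⟩ := fderiv_bound_aux hu (‖x₀‖ + 1 + K)
  have huc := hu.continuous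
  have key := intervalIntegral.hasFDerivAt_integral_of_dominated_of_fderiv_le (𝕜 := ℂ)
    (μ := volume) (a := a) (b := b)
    (F := fun x θ => c θ * u (x + γ θ)) (F' := fun x θ => c θ • fderiv ℂ u (x + γ θ))
    (x₀ := x₀) (s := Metric.ball x₀ 1) (bound := fun θ => ‖c θ‖ * M)
    (Metric.ball_mem_nhds _ one_pos) ?_ ?_ ?_ ?_ ?_ ?_
  · exact key.differentiableAt
  · refine Filter.Eventually.of_forall fun x => ?_
    exact Continuous.aestronglyMeasurable (by fun_prop)
  · exact Continuous.intervalIntegrable (by fun_prop) _ _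
  · apply Measurable.aestronglyMeasurable
    exact hc.measurable.smul ((measurable_fderiv ℂ u).comp (by fun_prop))
  · refine Filter.Eventually.of_forall fun θ _ x hx => ?_
    rw [norm_smul]
    gcongr
    apply hM
    have : ‖x - x₀‖ < 1 := by simpa [dist_eq_norm] using hx
    have h1 := norm_add_le x (γ θ)
    have h2 : ‖x‖ ≤ ‖x₀‖ + ‖x - x₀‖ := by
      simpa using norm_add_le x₀ (x - x₀)
    linarith [hγK θ]
  · exact Continuous.intervalIntegrable (by fun_prop) _ _
  · refine Filter.Eventually.of_forall fun θ _ x hx => ?_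
    have h1 : HasFDerivAt (fun x : Fin n → ℂ => u (x + γ θ)) (fderiv ℂ u (x + γ θ)) x :=
      (hasFDerivAt_comp_add_right (γ θ)).2 (hu (x + γ θ)).hasFDerivAt
    exact h1.const_mul (c θ)

lemma line_diff {n : ℕ} {u : (Fin n → ℂ) → ℂ} (hu : Differentiable ℂ u) (x v : Fin n → ℂ) :
    Differentiable ℂ (fun t : ℂ => u (x + t • v)) :=
  hu.comp (by fun_prop)

lemma line_deriv {n : ℕ} {u : (Fin n → ℂ) → ℂ} (hu : Differentiable ℂ u) (x : Fin n → ℂ)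
    (j : Fin n) (t : ℂ) :
    deriv (fun t : ℂ => u (x + t • Pi.single j 1)) t = pDeriv j u (x + t • Pi.single j 1) := by
  have h1 : HasDerivAt (fun t : ℂ => x + t • (Pi.single j 1 : Fin n → ℂ)) (Pi.single j 1) t := by
    simpa using ((hasDerivAt_id t).smul_const (Pi.single j 1 : Fin n → ℂ)).const_add x
  exact ((hu _).hasFDerivAt.comp_hasDerivAt t h1).deriv

lemma pDeriv_diff {n : ℕ} {u : (Fin n → ℂ) → ℂ} (hu : Differentiable ℂ u) (j : Fin n) :
    Differentiable ℂ (pDeriv j u) := by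
  have heq : pDeriv j u = fun x => (2 * Real.pi * Complex.I)⁻¹ *
      ∫ θ in (0:ℝ)..2 * Real.pi, (circleMap 0 1 θ * Complex.I * (1 / (circleMap 0 1 θ) ^ 2)) *
        u (x + circleMap 0 1 θ • Pi.single j 1) := by
    funext x
    have h1 := (line_diff hu x (Pi.single j 1)).differentiableOn.deriv_eq_smul_circleIntegral
      (c := 0) (R := 1) one_pos
    rw [line_deriv hu] at h1
    simp only [zero_smul, add_zero, sub_zero, smul_eq_mul] at h1
    rw [eq_inv_mul_iff_mul_eq₀ Complex.two_pi_I_ne_zero, ← h1, circleIntegral]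
    simp only [deriv_circleMap, smul_eq_mul, mul_assoc]
  rw [heq]
  apply Differentiable.const_mul
  refine diff_integral_aux hu (K := 1)
    (c := fun θ => circleMap 0 1 θ * Complex.I * (1 / (circleMap 0 1 θ) ^ 2))
    (γ := fun θ => circleMap 0 1 θ • Pi.single j 1) ?_ ?_ ?_ _ _
  · refine Continuous.mul (by fun_prop) (Continuous.div₀ (by fun_prop) (by fun_prop) ?_)
    intro θ
    simp
  · fun_prop
  · intro θ
    rw [norm_smul]
    simp [Pi.norm_single]

lemma pDeriv_iter_diff {n : ℕ} {u : (Fin n → ℂ) → ℂ} (hu : Differentiable ℂ u) (j : Fin n)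
    (k : ℕ) : Differentiable ℂ ((pDeriv j)^[k] u) := by
  induction k with
  | zero => exact hu
  | succ k ih => rw [Function.iterate_succ_apply']; exact pDeriv_diff ih j

lemma line_iter {n : ℕ} {u : (Fin n → ℂ) → ℂ} (hu : Differentiable ℂ u) (x : Fin n → ℂ)
    (j : Fin n) (k : ℕ) :
    iteratedDeriv k (fun t : ℂ => u (x + t • Pi.single j 1))
      = fun t => (pDeriv j)^[k] u (x + t • Pi.single j 1) := by
  induction k with
  | zero => simp
  | succ k ih =>
    rw [iteratedDeriv_succ, ih]
    funext t
    rw [Function.iterate_succ_apply', line_deriv (pDeriv_iter_diff hu j k)]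

lemma pDeriv_iter_bound {n : ℕ} {u : (Fin n → ℂ) → ℂ} (hu : Differentiable ℂ u) (j : Fin n)
    (k : ℕ) (x : Fin n → ℂ) (A : ℝ) (hA : ∀ y, ‖y‖ ≤ ‖x‖ + 1 → ‖u y‖ ≤ A) :
    ‖(pDeriv j)^[k] u x‖ ≤ k.factorial * A := by
  have h := Complex.norm_iteratedDeriv_le_of_forall_mem_sphere_norm_le (c := 0) (R := 1) (C := A)
    k one_pos (line_diff hu x (Pi.single j 1)).diffContOnCl (by
      intro z hz
      apply hA
      have hz' : ‖z‖ = 1 := by simpa using hz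
      refine (norm_add_le _ _).trans ?_
      rw [norm_smul]
      simp [hz', Pi.norm_single])
  rw [line_iter hu] at h
  simpa using h

lemma fold_bound {n : ℕ} {u : (Fin n → ℂ) → ℂ} (hu : Differentiable ℂ u) (α : Fin n → ℕ)
    (A : ℝ) (L : List (Fin n)) :
    Differentiable ℂ ((L.foldr (fun j f => (pDeriv j)^[α j] ∘ f) id) u) ∧
    ∀ m : ℝ, (∀ y, ‖y‖ ≤ m + L.length → ‖u y‖ ≤ A) → ∀ x, ‖x‖ ≤ m →
      ‖(L.foldr (fun j f => (pDeriv j)^[α j] ∘ f) id) u x‖ ≤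
        (L.map (fun j => ((α j).factorial : ℝ))).prod * A := by
  induction L with
  | nil => exact ⟨hu, fun m h x hx => by simpa using h x (by simpa using hx)⟩
  | cons j L ih =>
    obtain ⟨ih1, ih2⟩ := ih
    refine ⟨pDeriv_iter_diff ih1 j _, fun m h x hx => ?_⟩
    simp only [List.foldr_cons, Function.comp_apply, List.map_cons, List.prod_cons, mul_assoc]
    apply pDeriv_iter_bound ih1
    intro y hy
    refine ih2 (m + 1) (fun z hz => h z ?_) y (by linarith)
    push_cast [List.length_cons]
    linarith

lemma mDeriv_bound {n : ℕ} {u : (Fin n → ℂ) → ℂ} (hu : Differentiable ℂ u) (α : Fin n → ℕ)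
    (A : ℝ) (hA : ∀ y, ‖y‖ ≤ n → ‖u y‖ ≤ A) :
    ‖(∏ j, ((α j).factorial : ℂ))⁻¹ * mDeriv α u 0‖ ≤ A := by
  have h := (fold_bound hu α A (List.finRange n)).2 0 (by simpa using hA) 0 (by simp)
  rw [← Fin.prod_univ_def] at h
  have hpos : 0 < ∏ j, ((α j).factorial : ℝ) :=
    Finset.prod_pos fun j _ => by exact_mod_cast (α j).factorial_pos
  rw [norm_mul, norm_inv, norm_prod]
  simp only [Complex.norm_natCast]
  rw [inv_mul_le_iff₀ hpos]
  exact h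

lemma rot_aux {n : ℕ} (v : (Fin n → ℂ) → ℂ) (c : ℂ) (hc : ‖c‖ = 1) :
    ∫ w in Metric.closedBall (0 : Fin n → ℂ) 1, v (c • w)
      = ∫ w in Metric.closedBall (0 : Fin n → ℂ) 1, v w := by
  have hc0 : c ≠ 0 := by rintro rfl; simp at hc
  have hmp1 : MeasurePreserving (fun z : ℂ => c * z) volume volume := by
    have := (rotation ⟨c, by simpa [Submonoid.unitSphere] using hc⟩).measurePreserving
    exact this
  have hmp : MeasurePreserving (fun w : Fin n → ℂ => c • w) volume volume :=
    volume_preserving_pi (fun _ : Fin n => hmp1)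
  have hme : MeasurableEmbedding (fun w : Fin n → ℂ => c • w) :=
    (Homeomorph.smulOfNeZero c hc0).measurableEmbedding
  have := hmp.setIntegral_preimage_emb hme v (Metric.closedBall (0 : Fin n → ℂ) 1)
  rw [← this]
  congr 2
  ext w
  simp [norm_smul, hc]

lemma mean_aux {n : ℕ} {v : (Fin n → ℂ) → ℂ} (hv : Differentiable ℂ v) (x : Fin n → ℂ) :
    volume.real (Metric.closedBall (0 : Fin n → ℂ) 1) * v x
      = ∫ w in Metric.closedBall (0 : Fin n → ℂ) 1, v (x + w) := by
  have hvc := hv.continuous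
  have hpi := Real.two_pi_pos
  have hline : ∀ w : Fin n → ℂ,
      ∫ θ in Set.Ioc 0 (2 * Real.pi), v (x + circleMap 0 1 θ • w) = (2 * Real.pi : ℝ) * v x := by
    intro w
    have h := (line_diff hv x w).diffContOnCl (s := Metric.ball 0 |1|) |>.circleAverage
    simp only [Real.circleAverage, zero_smul, add_zero] at h
    rw [← intervalIntegral.integral_of_le hpi.le, ← h, Complex.real_smul, ← mul_assoc,
      ← Complex.ofReal_mul, mul_inv_cancel₀ hpi.ne', Complex.ofReal_one, one_mul]
  have hrot : ∀ θ : ℝ, ∫ w in Metric.closedBall (0 : Fin n → ℂ) 1, v (x + circleMap 0 1 θ • w)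
      = ∫ w in Metric.closedBall (0 : Fin n → ℂ) 1, v (x + w) := fun θ =>
    rot_aux (fun w => v (x + w)) (circleMap 0 1 θ) (by simp)
  have hprodInt : Integrable (Function.uncurry fun (θ : ℝ) (w : Fin n → ℂ) =>
      v (x + circleMap 0 1 θ • w)) ((volume.restrict (Set.Ioc 0 (2 * Real.pi))).prod
        (volume.restrict (Metric.closedBall (0 : Fin n → ℂ) 1))) := by
    rw [Measure.prod_restrict]
    have : IntegrableOn (Function.uncurry fun (θ : ℝ) (w : Fin n → ℂ) =>
      v (x + circleMap 0 1 θ • w)) (Set.Icc 0 (2 * Real.pi) ×ˢ Metric.closedBall 0 1)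
      (volume.prod volume) := by
      apply ContinuousOn.integrableOn_compact
      · exact isCompact_Icc.prod (isCompact_closedBall _ _)
      · apply Continuous.continuousOn
        simp only [Function.uncurry_def]
        fun_prop
    exact this.mono_set (Set.prod_mono Set.Ioc_subset_Icc_self le_rfl)
  have hswap := integral_integral_swap hprodInt
  simp only [hline, hrot] at hswap
  simp only [integral_const, measureReal_restrict_apply_univ, Real.volume_real_Ioc_of_le hpi.le,
    sub_zero, Complex.real_smul] at hswap
  have h2 : ((2 * Real.pi : ℝ) : ℂ) ≠ 0 := by exact_mod_cast hpi.ne'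
  apply mul_left_cancel₀ h2
  rw [hswap]
  ring

lemma submean {n : ℕ} {u : (Fin n → ℂ) → ℂ} (hu : Differentiable ℂ u) (x : Fin n → ℂ) :
    volume.real (Metric.closedBall (0 : Fin n → ℂ) 1) * ‖u x‖ ^ 2
      ≤ ∫ w in Metric.closedBall (0 : Fin n → ℂ) 1, ‖u (x + w)‖ ^ 2 := by
  have h := mean_aux (v := fun y => u y ^ 2) (by fun_prop) x
  have h2 := norm_integral_le_integral_norm (μ := volume.restrict (Metric.closedBall 0 1))
    (fun w => u (x + w) ^ 2)
  rw [← h] at h2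
  simpa [norm_pow, abs_of_nonneg] using h2

lemma eNormSq_le {n : ℕ} (x : Fin n → ℂ) : eNormSq x ≤ n * ‖x‖ ^ 2 := by
  have : ∀ j ∈ Finset.univ, Complex.normSq (x j) ≤ ‖x‖ ^ 2 := by
    intro j _
    rw [Complex.normSq_eq_norm_sq]
    gcongr
    exact norm_le_pi_norm x j
  simpa [eNormSq] using Finset.sum_le_card_nsmul _ _ _ this

lemma le_eNormSq {n : ℕ} (x : Fin n → ℂ) : ‖x‖ ^ 2 ≤ eNormSq x := by
  have h0 : 0 ≤ eNormSq x := Finset.sum_nonneg fun j _ => Complex.normSq_nonneg _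
  have : ‖x‖ ≤ Real.sqrt (eNormSq x) := by
    rw [pi_norm_le_iff_of_nonneg (Real.sqrt_nonneg _)]
    intro j
    apply Real.le_sqrt_of_sq_le
    rw [← Complex.normSq_eq_norm_sq]
    exact Finset.single_le_sum (f := fun j => Complex.normSq (x j))
      (fun j _ => Complex.normSq_nonneg _) (Finset.mem_univ j)
  calc ‖x‖ ^ 2 ≤ Real.sqrt (eNormSq x) ^ 2 := by gcongr
    _ = _ := Real.sq_sqrt h0

lemma gauss_int {n : ℕ} (C₁ : ℝ) (hC₁ : 1 ≤ C₁) :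
    Integrable (fun x : Fin n → ℂ => Real.exp (-(eNormSq x / C₁))) := by
  have h1 : Integrable (fun z : ℂ => Real.exp (-(Complex.normSq z / C₁))) := by
    have := (GaussianFourier.integrable_cexp_neg_mul_sq_norm_add (V := ℂ) (b := ((C₁⁻¹ : ℝ) : ℂ))
      (by simp; linarith) 0 0).norm
    refine this.congr (Filter.Eventually.of_forall fun z => ?_)
    simp only [Complex.norm_exp, Complex.normSq_eq_norm_sq]
    congr 1
    simp [← Complex.ofReal_pow, -Complex.ofReal_inv]
    ring
  have h2 := Integrable.fintype_prod (ι := Fin n) (fun _ => h1)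
  refine h2.congr (Filter.Eventually.of_forall fun x => ?_)
  simp only [eNormSq]
  rw [← Real.exp_sum, Finset.sum_div, Finset.sum_neg_distrib]

lemma taylor_bound {n : ℕ} {u : (Fin n → ℂ) → ℂ} (hu : Differentiable ℂ u) (N : ℕ)
    (A : ℝ) (hA : ∀ y, ‖y‖ ≤ n → ‖u y‖ ≤ A) (x : Fin n → ℂ) :
    ‖taylorTrunc N u x‖ ≤ Real.exp N ^ n * (A * Real.exp (N * ‖x‖)) := by
  have hA0 : 0 ≤ A := (norm_nonneg _).trans (hA 0 (by simp))
  have hcard : ((multiIdx n N).card : ℝ) ≤ Real.exp N ^ n := by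
    have h1 : (multiIdx n N).card ≤ N ^ n := by
      refine (Finset.card_filter_le _ _).trans ?_
      simp
    calc ((multiIdx n N).card : ℝ) ≤ (N : ℝ) ^ n := by exact_mod_cast h1
      _ ≤ _ := by
        gcongr
        linarith [Real.add_one_le_exp (N : ℝ)]
  have hterm : ∀ α ∈ multiIdx n N, ‖((∏ j, ((α j).factorial : ℂ)))⁻¹ * mDeriv α u 0
      * ∏ j, (x j) ^ α j‖ ≤ A * Real.exp (N * ‖x‖) := by
    intro α hα
    have hs : (∑ j, α j) < N := (Finset.mem_filter.1 hα).2
    rw [norm_mul]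
    refine mul_le_mul (mDeriv_bound hu α A hA) ?_ (norm_nonneg _) hA0
    rw [norm_prod]
    calc ∏ j, ‖x j ^ α j‖ ≤ ∏ j, Real.exp ‖x‖ ^ α j := by
          apply Finset.prod_le_prod (fun _ _ => norm_nonneg _)
          intro j _
          rw [norm_pow]
          gcongr
          have := norm_le_pi_norm x j
          linarith [Real.add_one_le_exp ‖x‖]
      _ = Real.exp ‖x‖ ^ (∑ j, α j) := Finset.prod_pow_eq_pow_sum _ _ _
      _ ≤ Real.exp ‖x‖ ^ N := pow_le_pow_right₀ (Real.one_le_exp (norm_nonneg _)) hs.le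
      _ = _ := by rw [← Real.exp_nat_mul]
  refine (norm_sum_le_of_le _ hterm).trans ?_
  rw [Finset.sum_const, nsmul_eq_mul]
  gcongr

lemma sup_bound {n : ℕ} (C₁ : ℝ) (hC₁ : 1 ≤ C₁)
    (Φ₁ : (Fin n → ℂ) → ℝ) (hup : ∀ x, Φ₁ x ≤ C₁ * eNormSq x)
    (h : ℝ) (hh : 0 < h) {u : (Fin n → ℂ) → ℂ} (hu : Differentiable ℂ u)
    (hg : Integrable (fun x : Fin n → ℂ => ‖u x‖ ^ 2 * Real.exp (-2 * Φ₁ x / h)))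
    (x : Fin n → ℂ) (hx : ‖x‖ ≤ n) :
    volume.real (Metric.closedBall (0 : Fin n → ℂ) 1) * ‖u x‖ ^ 2 ≤
      Real.exp (2 * C₁ * (n * (n + 1) ^ 2) / h) *
        ∫ x : Fin n → ℂ, ‖u x‖ ^ 2 * Real.exp (-2 * Φ₁ x / h) := by
  refine (submean hu x).trans ?_
  rw [← integral_add_left_eq_self (μ := volume)
    (fun y => ‖u y‖ ^ 2 * Real.exp (-2 * Φ₁ y / h)) x, ← integral_const_mul, ← integral_indicator
    Metric.isClosed_closedBall.measurableSet]
  apply integral_mono_of_nonneg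
  · exact Filter.Eventually.of_forall fun w => Set.indicator_nonneg (fun _ _ => by positivity) _
  · exact (hg.comp_add_left x).const_mul _
  · refine Filter.Eventually.of_forall fun w => ?_
    refine Set.indicator_le' (g := fun w => Real.exp (2 * C₁ * (n * (n + 1) ^ 2) / h) *
      (‖u (x + w)‖ ^ 2 * Real.exp (-2 * Φ₁ (x + w) / h))) ?_ ?_ w
    · intro w hw
      have hw' : ‖w‖ ≤ 1 := by simpa using hw
      have h1 : ‖x + w‖ ≤ n + 1 := (norm_add_le _ _).trans (by linarith)
      have h2 : Φ₁ (x + w) ≤ C₁ * (n * (n + 1) ^ 2) := by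
        refine (hup _).trans ?_
        refine mul_le_mul_of_nonneg_left ((eNormSq_le _).trans ?_) (by linarith)
        gcongr
      have h3 : 1 ≤ Real.exp (2 * C₁ * (n * (n + 1) ^ 2) / h) *
          Real.exp (-2 * Φ₁ (x + w) / h) := by
        rw [← Real.exp_add]
        apply Real.one_le_exp
        rw [← add_div]
        apply div_nonneg _ hh.le
        linarith
      calc ‖u (x + w)‖ ^ 2 ≤ ‖u (x + w)‖ ^ 2 * (Real.exp (2 * C₁ * (n * (n + 1) ^ 2) / h) *
          Real.exp (-2 * Φ₁ (x + w) / h)) := le_mul_of_one_le_right (by positivity) h3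
        _ = _ := by ring
    · intro w _
      positivity

/-- Let `|x|²/C₁ ≤ Φ₁(x) ≤ C₁|x|²` with `C₁ ≥ 1`. For every `M₀ > 0` there is
`C > 0` such that for all `h ∈ (0,1]`, all integers `N ≥ 1` with `Nh ≤ M₀`, and
every entire `u` with finite `H_{Φ₁}`-norm, `‖τ_N u‖_{H_{Φ₁}} ≤ C e^{C/h} ‖u‖_{H_{Φ₁}}`. -/
theorem statement_7 {n : ℕ} (C₁ : ℝ) (hC₁ : 1 ≤ C₁)
    (Φ₁ : (Fin n → ℂ) → ℝ)
    (hlow : ∀ x, eNormSq x / C₁ ≤ Φ₁ x) (hup : ∀ x, Φ₁ x ≤ C₁ * eNormSq x)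
    (M₀ : ℝ) (hM₀ : 0 < M₀) :
    ∃ C > 0, ∀ h : ℝ, 0 < h → h ≤ 1 → ∀ N : ℕ, 1 ≤ N → (N : ℝ) * h ≤ M₀ →
      ∀ u : (Fin n → ℂ) → ℂ, Differentiable ℂ u →
        Integrable (fun x : Fin n → ℂ => ‖u x‖ ^ 2 * Real.exp (-2 * Φ₁ x / h)) →
        hNorm Φ₁ h (taylorTrunc N u) ≤ C * Real.exp (C / h) * hNorm Φ₁ h u := by
  set V := volume.real (Metric.closedBall (0 : Fin n → ℂ) 1) with hV
  have hVpos : 0 < V := by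
    rw [hV, measureReal_def]
    exact ENNReal.toReal_pos (Metric.measure_closedBall_pos _ _ one_pos).ne'
      measure_closedBall_lt_top.ne
  set K := ∫ x : Fin n → ℂ, Real.exp (-(eNormSq x / C₁)) with hK
  have hK0 : 0 ≤ K := integral_nonneg fun _ => (Real.exp_pos _).le
  set D₁ : ℝ := 2 * C₁ * (n * (n + 1) ^ 2) with hD₁
  set D₂ : ℝ := 2 * n * M₀ + C₁ * M₀ ^ 2 with hD₂
  have hC0 : 0 < C₁ := by linarith
  have hD10 : 0 ≤ D₁ := by positivity
  have hD20 : 0 ≤ D₂ := by positivity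
  refine ⟨Real.sqrt (K / V) + (D₁ + D₂) + 1, by positivity, ?_⟩
  intro h hh h1 N hN hNh u hu hg
  set I := ∫ x : Fin n → ℂ, ‖u x‖ ^ 2 * Real.exp (-2 * Φ₁ x / h) with hI
  have hI0 : 0 ≤ I := integral_nonneg fun _ => by positivity
  set A := Real.sqrt (Real.exp (D₁ / h) * I / V) with hAdef
  have hA2 : A ^ 2 = Real.exp (D₁ / h) * I / V := Real.sq_sqrt (by positivity)
  have hA : ∀ y, ‖y‖ ≤ n → ‖u y‖ ≤ A := by
    intro y hy
    apply Real.le_sqrt_of_sq_le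
    rw [le_div_iff₀ hVpos, mul_comm]
    exact sup_bound C₁ hC₁ Φ₁ hup h hh hu hg y hy
  have hNM : (N : ℝ) ≤ M₀ / h := by rwa [le_div_iff₀ hh]
  have hpt : ∀ x, ‖taylorTrunc N u x‖ ^ 2 * Real.exp (-2 * Φ₁ x / h) ≤
      (A ^ 2 * Real.exp (D₂ / h)) * Real.exp (-(eNormSq x / C₁)) := by
    intro x
    have hS := le_eNormSq x
    have hr := norm_nonneg x
    have hS0 : 0 ≤ eNormSq x := (sq_nonneg _).trans hS
    have e1 : ‖taylorTrunc N u x‖ ^ 2 ≤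
        A ^ 2 * Real.exp (2 * (n * (M₀ / h)) + 2 * (M₀ / h * ‖x‖)) := by
      calc ‖taylorTrunc N u x‖ ^ 2 ≤ (Real.exp N ^ n * (A * Real.exp (N * ‖x‖))) ^ 2 := by
            gcongr
            exact taylor_bound hu N A hA x
        _ = A ^ 2 * Real.exp (2 * (n * N) + 2 * (N * ‖x‖)) := by
            rw [← Real.exp_nat_mul, Real.exp_add, mul_pow, mul_pow, ← Real.exp_nat_mul,
              ← Real.exp_nat_mul]
            push_cast
            ring
        _ ≤ _ := by gcongr
    have e2 : -2 * Φ₁ x / h ≤ -2 * (eNormSq x / C₁) / h := by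
      apply div_le_div_of_nonneg_right _ hh.le
      linarith [hlow x]
    have e3 : 2 * (M₀ * ‖x‖) ≤ C₁ * M₀ ^ 2 + eNormSq x / C₁ := by
      have : ‖x‖ ^ 2 / C₁ ≤ eNormSq x / C₁ := by gcongr
      have h4 : 0 ≤ (C₁ * M₀ - ‖x‖) ^ 2 / C₁ := by positivity
      have h5 : (C₁ * M₀ - ‖x‖) ^ 2 / C₁ = C₁ * M₀ ^ 2 - 2 * (M₀ * ‖x‖) + ‖x‖ ^ 2 / C₁ := by
        field_simp
        ring
      linarith
    have e4 : eNormSq x / C₁ ≤ eNormSq x / C₁ / h := by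
      rw [le_div_iff₀ hh]
      exact mul_le_of_le_one_right (by positivity) h1
    have e5 : 2 * (n * (M₀ / h)) + 2 * (M₀ / h * ‖x‖) + -2 * (eNormSq x / C₁) / h ≤
        D₂ / h + -(eNormSq x / C₁) := by
      have : (2 * (M₀ * ‖x‖)) / h ≤ (C₁ * M₀ ^ 2 + eNormSq x / C₁) / h := by gcongr
      have h6 : 2 * (n * (M₀ / h)) + 2 * (M₀ / h * ‖x‖) + -2 * (eNormSq x / C₁) / h
        = (2 * n * M₀) / h + (2 * (M₀ * ‖x‖)) / h - 2 * (eNormSq x / C₁ / h) := by ring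
      have h7 : D₂ / h = (2 * n * M₀) / h + (C₁ * M₀ ^ 2) / h := by rw [hD₂]; ring
      rw [add_div] at this
      rw [h6, h7]
      linarith
    calc ‖taylorTrunc N u x‖ ^ 2 * Real.exp (-2 * Φ₁ x / h)
        ≤ (A ^ 2 * Real.exp (2 * (n * (M₀ / h)) + 2 * (M₀ / h * ‖x‖))) *
          Real.exp (-2 * (eNormSq x / C₁) / h) := by gcongr
      _ = A ^ 2 * Real.exp (2 * (n * (M₀ / h)) + 2 * (M₀ / h * ‖x‖)
          + -2 * (eNormSq x / C₁) / h) := by rw [mul_assoc, ← Real.exp_add]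
      _ ≤ A ^ 2 * Real.exp (D₂ / h + -(eNormSq x / C₁)) := by gcongr
      _ = _ := by rw [mul_assoc, ← Real.exp_add]
  have hJ : ∫ x : Fin n → ℂ, ‖taylorTrunc N u x‖ ^ 2 * Real.exp (-2 * Φ₁ x / h) ≤
      (K / V) * Real.exp ((D₁ + D₂) / h) * I := by
    calc ∫ x : Fin n → ℂ, ‖taylorTrunc N u x‖ ^ 2 * Real.exp (-2 * Φ₁ x / h)
        ≤ ∫ x : Fin n → ℂ, (A ^ 2 * Real.exp (D₂ / h)) * Real.exp (-(eNormSq x / C₁)) := by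
          apply integral_mono_of_nonneg
          · exact Filter.Eventually.of_forall fun w => by positivity
          · exact (gauss_int C₁ hC₁).const_mul _
          · exact Filter.Eventually.of_forall hpt
      _ = _ := by
          rw [integral_const_mul, hA2, ← hK, add_div D₁ D₂ h, Real.exp_add (D₁ / h) (D₂ / h)]
          ring
  unfold hNorm
  rw [← hI]
  set Cc := Real.sqrt (K / V) + (D₁ + D₂) + 1 with hCc
  have hs0 := Real.sqrt_nonneg (K / V)
  have hC1 : Real.sqrt (K / V) ≤ Cc := by linarith
  have hC2 : D₁ + D₂ ≤ 2 * Cc := by linarith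
  have hCp : 0 ≤ Cc := by linarith
  apply Real.sqrt_le_iff.2
  refine ⟨by positivity, hJ.trans ?_⟩
  rw [mul_pow, Real.sq_sqrt hI0, mul_pow, ← Real.exp_nat_mul]
  have hKV : K / V ≤ Cc ^ 2 := by
    rw [← Real.sq_sqrt (by positivity : 0 ≤ K / V)]
    gcongr
  have hexp : Real.exp ((D₁ + D₂) / h) ≤ Real.exp ((2 : ℕ) * (Cc / h)) := by
    apply Real.exp_le_exp.2
    rw [← mul_div_assoc]
    push_cast
    gcongr
  gcongr
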